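/- Let X be a topological space, x₀ ∈ X, and let g be an element of the fundamental group π₁(X, x₀) with g² = 1. Then there exist a point b ∈ ℝP² and a continuous map f : ℝP² → X with f(b) = x₀ such that g lies in the image of the induced homomorphism π₁(ℝP², b) → π₁(X, x₀); moreover, if g ≠ 1 then this induced homomorphism is injective. -/

import Mathlib

open CategoryTheory

/-- The quotient topology on the projectivization, induced from the nonzero vectors. -/
instance projectivizationTopology {K V : Type*} [DivisionRing K] [AddCommGroup V]
    [Module K V] [TopologicalSpace V] : TopologicalSpace (Projectivization K V) :=
  instTopologicalSpaceQuotient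

/-- The homomorphism of fundamental groups induced by a continuous map. -/
noncomputable def inducedPiOneHom {X Y : Type} [TopologicalSpace X] [TopologicalSpace Y]
    (f : C(X, Y)) (x : X) :
    FundamentalGroup X x →* FundamentalGroup Y (f x) :=
  Functor.mapEnd (FundamentalGroupoid.mk x)
    ((FundamentalGroupoid.fundamentalGroupoidFunctor.map
        (X := TopCat.of X) (Y := TopCat.of Y) (TopCat.ofHom f) :
        FundamentalGroupoid.fundamentalGroupoidFunctor.obj (TopCat.of X) ⟶
          FundamentalGroupoid.fundamentalGroupoidFunctor.obj (TopCat.of Y)) :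
      FundamentalGroupoid X ⥤ FundamentalGroupoid Y)

/-- Transport of the fundamental group along an equality of basepoints. -/
noncomputable def fundamentalGroupCongr {X : Type} [TopologicalSpace X] {x y : X}
    (h : x = y) : FundamentalGroup X x ≃* FundamentalGroup X y := by
  subst h; exact MulEquiv.refl _

section SimplyConnected

open Set unitInterval

variable {E : Type*} [NormedAddCommGroup E] [NormedSpace ℝ E]

theorem exists_contDiff_near_of_continuous [FiniteDimensional ℝ E] {γ : ℝ → E}
    (hγ : Continuous γ) {ε : ℝ} (hε : 0 < ε) :
    ∃ p : ℝ → E, ContDiff ℝ 1 p ∧ ∀ t ∈ Icc (0 : ℝ) 1, ‖p t - γ t‖ < ε := by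
  let e : E ≃L[ℝ] (Fin (Module.finrank ℝ E) → ℝ) :=
    ContinuousLinearEquiv.ofFinrankEq (by simp)
  let C : ℝ := ‖(e.symm : (Fin (Module.finrank ℝ E) → ℝ) →L[ℝ] E)‖ + 1
  have hC : 0 < C := by positivity
  choose P hP using fun i ↦ exists_polynomial_near_of_continuousOn 0 1 (fun t ↦ e (γ t) i)
    (by fun_prop) (ε / C) (by positivity)
  refine ⟨fun t ↦ e.symm fun i ↦ (P i).eval t, ?_, fun t ht ↦ ?_⟩
  · exact e.symm.contDiff.comp (contDiff_pi.2 fun i ↦ by simpa using (P i).contDiff_aeval (𝕜 := ℝ) 1)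
  · let w : Fin (Module.finrank ℝ E) → ℝ := (fun i ↦ (P i).eval t) - e (γ t)
    have hw : ‖w‖ < ε / C := (pi_norm_lt_iff (by positivity)).2 fun i ↦ hP i t ht
    have hew : e.symm (fun i ↦ (P i).eval t) - γ t = e.symm w := by simp [w]
    rw [hew]
    calc ‖e.symm w‖ ≤ (C - 1) * ‖w‖ := by
          simpa [C] using (e.symm : (Fin (Module.finrank ℝ E) → ℝ) →L[ℝ] E).le_opNorm w
      _ ≤ C * ‖w‖ := by gcongr; linarith
      _ < C * (ε / C) := by gcongr
      _ = ε := by field_simp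

/-- A continuous path can be approximated by a `C¹` path with the same endpoints. -/
theorem Path.exists_contDiff_near [FiniteDimensional ℝ E] {x y : E} (γ : Path x y)
    {ε : ℝ} (hε : 0 < ε) :
    ∃ p : ℝ → E, ContDiff ℝ 1 p ∧ p 0 = x ∧ p 1 = y ∧ ∀ t : I, ‖p t - γ t‖ < ε := by
  obtain ⟨q, hq, hqγ⟩ := exists_contDiff_near_of_continuous γ.continuous_extend (half_pos hε)
  have h0 : ‖q 0 - x‖ < ε / 2 := by simpa using hqγ 0 (by simp)
  have h1 : ‖q 1 - y‖ < ε / 2 := by simpa using hqγ 1 (by simp)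
  refine ⟨fun t ↦ q t - ((1 - t) • (q 0 - x) + t • (q 1 - y)), by fun_prop, by simp, by simp,
    fun t ↦ ?_⟩
  have ht : ‖q t - γ t‖ < ε / 2 := by simpa using hqγ t t.2
  have hmem : (1 - (t : ℝ)) • (q 0 - x) + (t : ℝ) • (q 1 - y) ∈ Metric.ball (0 : E) (ε / 2) :=
    convex_ball 0 (ε / 2) (by simpa using h0) (by simpa using h1)
      (sub_nonneg.2 t.2.2) t.2.1 (by simp)
  rw [mem_ball_zero_iff] at hmem
  calc _ = ‖(q t - (γ t : E)) - ((1 - (t : ℝ)) • (q 0 - x) + (t : ℝ) • (q 1 - y))‖ := by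
        congr 1; exact sub_right_comm _ _ _
    _ ≤ _ := norm_sub_le _ _
    _ < ε := by linarith

/-- Two paths of nonzero vectors that are close to each other are homotopic. -/
theorem Path.Homotopic.of_norm_sub_lt {x y : {v : E // v ≠ 0}} (γ γ' : Path x y)
    (h : ∀ t, ‖(γ' t : E) - γ t‖ < ‖(γ t : E)‖) : γ.Homotopic γ' := by
  have hne (s t : I) : AffineMap.lineMap (γ t : E) (γ' t : E) (s : ℝ) ≠ 0 := by
    intro h0
    rw [AffineMap.lineMap_apply_module', add_eq_zero_iff_eq_neg'] at h0
    have : ‖(γ t : E)‖ ≤ ‖(γ' t : E) - γ t‖ := by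
      conv_lhs => rw [h0, norm_neg, norm_smul, Real.norm_of_nonneg s.2.1]
      exact mul_le_of_le_one_left (norm_nonneg ((γ' t : E) - γ t)) s.2.2
    exact (h t).not_ge this
  exact ⟨{
    toFun := fun z ↦ ⟨_, hne z.1 z.2⟩
    continuous_toFun := by
      refine Continuous.subtype_mk ?_ _
      simp only [AffineMap.lineMap_apply_module]
      fun_prop
    map_zero_left := by simp
    map_one_left := by simp
    prop' := by
      rintro s t (rfl | rfl) <;> simp }⟩

theorem pathConnectedSpace_ne_zero (h : 1 < Module.finrank ℝ E) :
    PathConnectedSpace {v : E // v ≠ 0} := by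
  have h' : 1 < Module.rank ℝ E := by
    simpa using Module.lt_rank_of_lt_finrank h
  exact isPathConnected_iff_pathConnectedSpace.1
    (isPathConnected_compl_singleton_of_one_lt_rank h' (0 : E))

theorem simplyConnectedSpace_ne_zero [FiniteDimensional ℝ E] (h : 2 < Module.finrank ℝ E) :
    SimplyConnectedSpace {v : E // v ≠ 0} := by
  refine simply_connected_iff_loops_nullhomotopic.2 ⟨pathConnectedSpace_ne_zero (by lia), fun x γ ↦ ?_⟩
  obtain ⟨ε, hε, hεγ⟩ : ∃ ε > 0, ∀ t, ε ≤ ‖(γ t : E)‖ := by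
    obtain ⟨t₀, ht₀⟩ := (continuous_norm.comp
      (continuous_subtype_val.comp γ.continuous)).exists_forall_le' 0 (by simp)
    exact ⟨_, norm_pos_iff.2 (γ t₀).2, ht₀⟩
  obtain ⟨p, hp, hp0, hp1, hpγ⟩ := (γ.map continuous_subtype_val).exists_contDiff_near hε
  have hpγ' (t : I) : ‖p t - γ t‖ < ‖(γ t : E)‖ := (hpγ t).trans_le (hεγ t)
  have hpne (t : I) : p t ≠ 0 := fun h0 ↦ by simpa [h0] using hpγ' t
  obtain ⟨v, hv⟩ : ∃ v : E, v ∉ range fun z : ℝ × ℝ ↦ z.1 • p z.2 :=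
    (ContDiff.dense_compl_range_of_finrank_lt_finrank (by fun_prop) (by simpa)).nonempty
  have hv0 : v ≠ 0 := by
    rintro rfl
    exact hv ⟨(0, 0), by simp⟩
  let S : Set E := {w | ∀ a ∈ Icc (0 : ℝ) 1, a • w + (1 - a) • v ≠ 0}
  have hS : StarConvex ℝ v S := by
    rintro w hw c b hc hb hcb a ha
    have := hw (a * b) ⟨mul_nonneg ha.1 hb, mul_le_one₀ ha.2 hb (by linarith)⟩
    convert this using 1
    rw [show c = 1 - b by linarith]
    module
  have hpS (t : I) : p t ∈ S := by
    intro a ha h0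
    rcases eq_or_ne a 1 with rfl | ha1
    · exact hpne t (by simpa using h0)
    · have : 1 - a ≠ 0 := sub_ne_zero.2 ha1.symm
      refine hv ⟨(-(1 - a)⁻¹ * a, t), ?_⟩
      rw [add_eq_zero_iff_eq_neg] at h0
      simp only [mul_smul, h0, smul_neg, neg_smul, neg_neg]
      rw [inv_smul_smul₀ this]
  have hxS : (x : E) ∈ S := by simpa [hp0] using hpS 0
  have : ContractibleSpace S := hS.contractibleSpace ⟨x, hxS⟩
  let q : Path (⟨x, hxS⟩ : S) ⟨x, hxS⟩ :=
    { toFun := fun t ↦ ⟨p t, hpS t⟩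
      continuous_toFun := by have := hp.continuous; fun_prop
      source' := by simpa using hp0
      target' := by simpa using hp1 }
  let j : C(S, {v : E // v ≠ 0}) :=
    ⟨fun w ↦ ⟨w, by simpa using w.2 1 (by simp)⟩, by fun_prop⟩
  exact (Path.Homotopic.of_norm_sub_lt γ (q.map j.continuous) hpγ').trans
    ((SimplyConnectedSpace.paths_homotopic q (Path.refl _)).map j)

end SimplyConnected

namespace Projectivization

open Metric Topology

variable {E : Type*} [NormedAddCommGroup E] [NormedSpace ℝ E]

theorem continuous_mk' : Continuous (mk' ℝ : {v : E // v ≠ 0} → Projectivization ℝ E) :=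
  continuous_quotient_mk'

theorem isQuotientMap_mk' : IsQuotientMap (mk' ℝ : {v : E // v ≠ 0} → Projectivization ℝ E) :=
  isQuotientMap_quotient_mk'

/-- The inclusion of the unit sphere in the nonzero vectors. -/
def sphereToNeZero : C(sphere (0 : E) 1, {v : E // v ≠ 0}) :=
  ⟨fun v ↦ ⟨v, ne_zero_of_mem_unit_sphere v⟩, by fun_prop⟩

theorem isQuotientMap_mk'_sphere : IsQuotientMap (mk' ℝ ∘ sphereToNeZero (E := E)) := by
  let n : {v : E // v ≠ 0} → sphere (0 : E) 1 := fun v ↦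
    ⟨‖(v : E)‖⁻¹ • (v : E), by simp [norm_smul, v.2]⟩
  have hn : Continuous n := by
    refine Continuous.subtype_mk (Continuous.smul (Continuous.inv₀ (by fun_prop) ?_)
      continuous_subtype_val) _
    simp
  refine IsQuotientMap.of_comp hn (continuous_mk'.comp (map_continuous _)) ?_
  convert isQuotientMap_mk' (E := E) using 1
  ext v
  simp only [Function.comp_apply, mk'_eq_mk, mk_eq_mk_iff']
  exact ⟨‖(v : E)‖⁻¹, rfl⟩

theorem mk'_sphere_eq_iff {v w : sphere (0 : E) 1} :
    mk' ℝ (sphereToNeZero v) = mk' ℝ (sphereToNeZero w) ↔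
      v ∈ MulAction.orbit (sphere (0 : ℝ) 1) w := by
  simp only [mk'_eq_mk, mk_eq_mk_iff']
  constructor
  · rintro ⟨a, ha⟩
    have ha' : a • (w : E) = v := ha
    have hn : ‖a‖ = 1 := by simpa [norm_smul] using congrArg norm ha'
    exact ⟨⟨a, by simpa using hn⟩, Subtype.ext ha'⟩
  · rintro ⟨a, rfl⟩
    exact ⟨a, rfl⟩

instance : Finite (sphere (0 : ℝ) 1) := by
  rw [Set.finite_coe_iff]
  refine Set.Finite.subset (Set.toFinite {1, -1}) fun a ha ↦ ?_
  rw [mem_sphere_zero_iff_norm, Real.norm_eq_abs] at ha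
  exact eq_or_eq_neg_of_abs_eq ha

instance : ContinuousConstSMul (sphere (0 : ℝ) 1) (sphere (0 : E) 1) :=
  ⟨fun _ ↦ continuous_const_smul _⟩

instance : IsCancelSMul (sphere (0 : ℝ) 1) (sphere (0 : E) 1) where
  left_cancel' a v w h := by simpa using congrArg (a⁻¹ • ·) h
  right_cancel' a b v h := Subtype.ext <|
    smul_left_injective ℝ (ne_zero_of_mem_unit_sphere v) (congrArg Subtype.val h)

variable [FiniteDimensional ℝ E]

theorem isCoveringMap_mk'_sphere : IsCoveringMap (mk' ℝ ∘ sphereToNeZero (E := E)) := by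
  have : ProperSpace E := FiniteDimensional.proper_real E
  have h := isQuotientMap_mk'_sphere.isQuotientCoveringMap_of_properlyDiscontinuousSMul
    (E := sphere (0 : E) 1) (G := sphere (0 : ℝ) 1) (f := mk' ℝ ∘ sphereToNeZero)
  exact (h mk'_sphere_eq_iff).isCoveringMap

instance : T2Space (Projectivization ℝ E) := by
  have : ProperSpace E := FiniteDimensional.proper_real E
  let f : C(sphere (0 : E) 1, Projectivization ℝ E) := ⟨_, isQuotientMap_mk'_sphere.continuous⟩
  have hf : IsQuotientMap f := isQuotientMap_mk'_sphere
  let φ := hf.homeomorph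
  have h : Setoid.ker (mk' ℝ ∘ sphereToNeZero (E := E)) =
      MulAction.orbitRel (sphere (0 : ℝ) 1) (sphere (0 : E) 1) :=
    Setoid.ext fun _ _ ↦ mk'_sphere_eq_iff
  have : T2Space (Quotient (Setoid.ker (mk' ℝ ∘ sphereToNeZero (E := E)))) := by
    rw [h]
    infer_instance
  exact φ.t2Space

end Projectivization

namespace Projectivization

open Metric Topology unitInterval

section Loops

variable {E : Type*} [NormedAddCommGroup E] [NormedSpace ℝ E]

theorem mk'_eq_of_eq_neg {v w : {v : E // v ≠ 0}} (h : (w : E) = -v) : mk' ℝ v = mk' ℝ w := by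
  rw [mk'_eq_mk, mk'_eq_mk, mk_eq_mk_iff']
  exact ⟨-1, by simp [h]⟩

/-- The loop in projective space represented by a path joining a vector to its opposite. -/
noncomputable def loopOfPath {v w : {v : E // v ≠ 0}} (δ : Path v w) (h : (w : E) = -v) :
    Path (mk' ℝ v) (mk' ℝ v) :=
  (δ.map continuous_mk').cast rfl (mk'_eq_of_eq_neg h)

/-- A loop in a real projective space of dimension at least two is either null-homotopic or
homotopic to a given loop whose lift joins two opposite vectors. -/
theorem homotopic_refl_or_loopOfPath [FiniteDimensional ℝ E] (hE : 2 < Module.finrank ℝ E)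
    {v w : {v : E // v ≠ 0}} (hv : ‖(v : E)‖ = 1) (δ : Path v w) (h : (w : E) = -v)
    (γ : Path (mk' ℝ v) (mk' ℝ v)) :
    γ.Homotopic (Path.refl _) ∨ γ.Homotopic (loopOfPath δ h) := by
  have := simplyConnectedSpace_ne_zero hE
  let u : sphere (0 : E) 1 := ⟨v, by simpa using hv⟩
  obtain ⟨Γ, hΓ, hΓ0⟩ := isCoveringMap_mk'_sphere.exists_path_lifts (γ : C(I, _)) u γ.source
  have hΓ' (t : I) : mk' ℝ (sphereToNeZero (Γ t)) = γ t := congrFun hΓ t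
  obtain ⟨a, ha⟩ : Γ 1 ∈ MulAction.orbit (sphere (0 : ℝ) 1) u :=
    mk'_sphere_eq_iff.1 ((hΓ' 1).trans γ.target)
  have ha' : (a : ℝ) • (v : E) = Γ 1 := congrArg Subtype.val ha
  have hv0 : sphereToNeZero (Γ 0) = v := by rw [hΓ0]; rfl
  have haa : (a : ℝ) = 1 ∨ (a : ℝ) = -1 :=
    eq_or_eq_neg_of_abs_eq (by
      rw [← Real.norm_eq_abs]; exact mem_sphere_zero_iff_norm.1 a.2)
  rcases haa with h1 | h1
  · have hv1 : sphereToNeZero (Γ 1) = v := Subtype.ext (ha'.symm.trans (by simp [h1]))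
    let Γ' : Path v v := ⟨sphereToNeZero.comp Γ, hv0, hv1⟩
    have hγ : γ = Γ'.map continuous_mk' := Path.ext (funext fun t ↦ (hΓ' t).symm)
    rw [hγ]
    exact .inl ((SimplyConnectedSpace.paths_homotopic Γ' (Path.refl v)).map
      ⟨_, continuous_mk' (E := E)⟩)
  · have hv1 : sphereToNeZero (Γ 1) = w := Subtype.ext (ha'.symm.trans (by simp [h1, h]))
    let Γ' : Path v w := ⟨sphereToNeZero.comp Γ, hv0, hv1⟩
    have hγ : γ = loopOfPath Γ' h := Path.ext (funext fun t ↦ (hΓ' t).symm)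
    rw [hγ]
    exact .inr ((SimplyConnectedSpace.paths_homotopic Γ' δ).map ⟨_, continuous_mk' (E := E)⟩)

end Loops

section Hemisphere

open Real

/-- Polar coordinates on a model of the upper hemisphere: `s` is the height and `2πt` the
angle. -/
noncomputable def hemisphere (s t : ℝ) : EuclideanSpace ℝ (Fin 3) :=
  !₂[(1 - s) * cos (2 * π * t), (1 - s) * sin (2 * π * t), s]

theorem hemisphere_ne_zero (s t : ℝ) : hemisphere s t ≠ 0 := by
  intro h
  have h0 : (1 - s) * cos (2 * π * t) = 0 := by simpa [hemisphere] using congr($h 0)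
  have h1 : (1 - s) * sin (2 * π * t) = 0 := by simpa [hemisphere] using congr($h 1)
  have h2 : s = 0 := by simpa [hemisphere] using congr($h 2)
  subst h2
  nlinarith [sin_sq_add_cos_sq (2 * π * t)]

theorem continuous_hemisphere : Continuous fun z : ℝ × ℝ ↦ hemisphere z.1 z.2 := by
  unfold hemisphere
  refine (PiLp.continuous_toLp 2 _).comp (continuous_pi fun i ↦ ?_)
  fin_cases i <;> simp <;> fun_prop

/-- The parametrization of the projective plane by polar coordinates on the hemisphere. -/
noncomputable def ofPolar : C(I × I, Projectivization ℝ (EuclideanSpace ℝ (Fin 3))) where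
  toFun z := mk' ℝ ⟨hemisphere z.1 z.2, hemisphere_ne_zero _ _⟩
  continuous_toFun := continuous_mk'.comp <| Continuous.subtype_mk
    (continuous_hemisphere.comp (by fun_prop : Continuous fun z : I × I ↦ ((z.1 : ℝ), (z.2 : ℝ)))) _

theorem exists_polar (x y : ℝ) : ∃ t : I,
    x = √(x ^ 2 + y ^ 2) * cos (2 * π * t) ∧ y = √(x ^ 2 + y ^ 2) * sin (2 * π * t) := by
  let z : ℂ := ⟨x, y⟩
  have hz : ‖z‖ = √(x ^ 2 + y ^ 2) := by
    rw [Complex.norm_eq_sqrt_sq_add_sq]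
  refine ⟨⟨Int.fract (z.arg / (2 * π)), Int.fract_nonneg _, (Int.fract_lt_one _).le⟩, ?_⟩
  have harg : 2 * π * Int.fract (z.arg / (2 * π)) =
      z.arg - ⌊z.arg / (2 * π)⌋ * (2 * π) := by
    rw [Int.fract]
    field_simp
  simp only [harg, cos_sub_int_mul_two_pi, sin_sub_int_mul_two_pi, ← hz,
    Complex.norm_mul_cos_arg, Complex.norm_mul_sin_arg]
  exact ⟨rfl, rfl⟩

theorem ofPolar_surjective : Function.Surjective ofPolar := by
  suffices h : ∀ v : {v : EuclideanSpace ℝ (Fin 3) // v ≠ 0}, 0 ≤ (v : EuclideanSpace ℝ (Fin 3)) 2 →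
      ∃ z, ofPolar z = mk' ℝ v by
    intro p
    obtain ⟨v, rfl⟩ := isQuotientMap_mk'.surjective p
    rcases le_total 0 ((v : EuclideanSpace ℝ (Fin 3)) 2) with hv | hv
    · exact h v hv
    · obtain ⟨z, hz⟩ := h ⟨-v, neg_ne_zero.2 v.2⟩ (by simpa using hv)
      exact ⟨z, hz.trans (mk'_eq_of_eq_neg rfl).symm⟩
  rintro ⟨v, hv0⟩ hv
  obtain ⟨t, hx, hy⟩ := exists_polar (v 0) (v 1)
  set r := √(v 0 ^ 2 + v 1 ^ 2)
  have hr : 0 ≤ r := sqrt_nonneg _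
  have hN : 0 < r + v 2 := by
    refine lt_of_le_of_ne (by positivity) fun h ↦ hv0 ?_
    have hr0 : r = 0 := by linarith
    have h2 : v 2 = 0 := by linarith
    ext i
    fin_cases i
    · simpa [hr0] using hx
    · simpa [hr0] using hy
    · simpa using h2
  refine ⟨(⟨v 2 / (r + v 2), by positivity, div_le_one_of_le₀ (by linarith) hN.le⟩, t), ?_⟩
  simp only [ofPolar, ContinuousMap.coe_mk, mk'_eq_mk, mk_eq_mk_iff']
  refine ⟨(r + v 2)⁻¹, ?_⟩
  have h1 : 1 - v 2 / (r + v 2) = (r + v 2)⁻¹ * r := by field_simp; ring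
  ext i
  fin_cases i
  · simpa [hemisphere, h1, mul_assoc] using Or.inl (hx.trans (by rw [mul_assoc 2]))
  · simpa [hemisphere, h1, mul_assoc] using Or.inl (hy.trans (by rw [mul_assoc 2]))
  · simp [hemisphere, div_eq_inv_mul]

theorem isQuotientMap_ofPolar : IsQuotientMap ofPolar :=
  IsQuotientMap.of_surjective_continuous ofPolar_surjective ofPolar.continuous

theorem sub_mem_int_of_cos_eq_of_sin_eq {t t' : ℝ} (hc : cos (2 * π * t) = cos (2 * π * t'))
    (hs : sin (2 * π * t) = sin (2 * π * t')) : ∃ k : ℤ, t - t' = k := by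
  obtain ⟨k, hk⟩ := Real.Angle.angle_eq_iff_two_pi_dvd_sub.1 (Real.Angle.cos_sin_inj hc hs)
  refine ⟨k, mul_left_cancel₀ two_pi_pos.ne' ?_⟩
  linarith

/-- The identifications made by polar coordinates on the projective plane. -/
theorem ofPolar_eq_imp {s t s' t' : I} (h : ofPolar (s, t) = ofPolar (s', t')) :
    s = s' ∧ (s = 1 ∨ ∃ k : ℤ, (t : ℝ) - t' = k) ∨
      s = 0 ∧ s' = 0 ∧ ∃ k : ℤ, (t : ℝ) - t' = k + 1 / 2 := by
  simp only [ofPolar, ContinuousMap.coe_mk, mk'_eq_mk, mk_eq_mk_iff'] at h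
  obtain ⟨a, ha⟩ := h
  have h0 : a * ((1 - s') * cos (2 * π * t')) = (1 - s) * cos (2 * π * t) := by
    simpa [hemisphere] using congr($ha 0)
  have h1 : a * ((1 - s') * sin (2 * π * t')) = (1 - s) * sin (2 * π * t) := by
    simpa [hemisphere] using congr($ha 1)
  have h2 : a * s' = (s : ℝ) := by simpa [hemisphere] using congr($ha 2)
  have hs0 := s.2.1
  have hs1 := s.2.2
  have hs0' := s'.2.1
  have hs1' := s'.2.2
  have hsq : (a * (1 - s')) ^ 2 = (1 - (s : ℝ)) ^ 2 := by
    have e := sin_sq_add_cos_sq (2 * π * t)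
    have e' := sin_sq_add_cos_sq (2 * π * t')
    calc (a * (1 - s')) ^ 2
        = (a * ((1 - s') * sin (2 * π * t'))) ^ 2 + (a * ((1 - s') * cos (2 * π * t'))) ^ 2 := by
          linear_combination -(a * (1 - s')) ^ 2 * e'
      _ = (1 - (s : ℝ)) ^ 2 := by
          rw [h0, h1]
          linear_combination (1 - (s : ℝ)) ^ 2 * e
  rcases sq_eq_sq_iff_eq_or_eq_neg.1 hsq with h3 | h3
  · have ha1 : a = 1 := by linarith
    subst ha1
    have hss : s = s' := Subtype.ext (by linarith)
    subst hss
    refine .inl ⟨rfl, ?_⟩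
    rcases eq_or_ne s 1 with hs | hs
    · exact .inl hs
    · have hne : 1 - (s : ℝ) ≠ 0 := sub_ne_zero.2 fun h ↦ hs (Subtype.ext h.symm)
      rw [one_mul] at h0 h1
      exact .inr (sub_mem_int_of_cos_eq_of_sin_eq (mul_left_cancel₀ hne h0.symm)
        (mul_left_cancel₀ hne h1.symm))
  · have ha1 : a = 2 * s - 1 := by linarith
    rcases le_or_gt 0 a with ha0 | ha0
    · have hs : (s : ℝ) = 1 := by nlinarith
      have hs' : (s' : ℝ) = 1 := by rw [ha1, hs] at h2; linarith
      exact .inl ⟨Subtype.ext (hs.trans hs'.symm), .inl (Subtype.ext hs)⟩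
    · have hs : (s : ℝ) = 0 := by nlinarith
      have hs' : (s' : ℝ) = 0 := by rw [ha1, hs] at h2; linarith
      rw [ha1, hs, hs'] at h0 h1
      have e : 2 * π * (t' + 1 / 2 : ℝ) = 2 * π * t' + π := by ring
      obtain ⟨k, hk⟩ := sub_mem_int_of_cos_eq_of_sin_eq (t := t) (t' := t' + 1 / 2)
        (by rw [e, cos_add_pi]; linarith) (by rw [e, sin_add_pi]; linarith)
      exact .inr ⟨Subtype.ext hs, Subtype.ext hs', k, by linarith⟩

end Hemisphere

end Projectivization

section Extension

open unitInterval

variable {X : Type*} [TopologicalSpace X] {x₀ : X}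

theorem Path.trans_self_apply_eq_fract (γ : Path x₀ x₀) (t : I) :
    γ.trans γ t = γ ⟨Int.fract (2 * (t : ℝ)), Int.fract_nonneg _, (Int.fract_lt_one _).le⟩ := by
  have h0 := t.2.1
  have h1 := t.2.2
  rcases lt_or_ge (t : ℝ) (1 / 2) with h | h
  · rw [Path.trans_apply, dif_pos h.le]
    congr 2
    exact (Int.fract_eq_self.2 ⟨by linarith, by linarith⟩).symm
  rcases h1.lt_or_eq with h' | h'
  · have hf : Int.fract (2 * (t : ℝ)) = 2 * t - 1 :=
      Int.fract_eq_iff.2 ⟨by linarith, by linarith, 1, by simp⟩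
    simp only [hf]
    rcases h.lt_or_eq with h2 | h2
    · rw [Path.trans_apply, dif_neg h2.not_ge]
    · rw [Path.trans_apply, dif_pos h2.ge]
      simp [← h2]
  · have ht : t = 1 := Subtype.ext h'
    subst ht
    simp

theorem Path.Homotopy.factorsThrough_ofPolar {γ : Path x₀ x₀}
    (H : Path.Homotopy (γ.trans γ) (Path.refl x₀)) :
    Function.FactorsThrough H Projectivization.ofPolar := by
  rintro ⟨s, t⟩ ⟨s', t'⟩ h
  rcases Projectivization.ofPolar_eq_imp h with ⟨rfl, rfl | ⟨k, hk⟩⟩ | ⟨rfl, rfl, k, hk⟩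
  · simp
  · have h0 := t.2
    have h0' := t'.2
    have hk1 : -1 ≤ k := by
      have : ((-1 : ℤ) : ℝ) ≤ k := by rw [← hk]; push_cast; linarith [h0.1, h0'.2]
      exact_mod_cast this
    have hk2 : k ≤ 1 := by
      have : (k : ℝ) ≤ (1 : ℤ) := by rw [← hk]; push_cast; linarith [h0.2, h0'.1]
      exact_mod_cast this
    obtain rfl | rfl | rfl : k = -1 ∨ k = 0 ∨ k = 1 := by omega
    · push_cast at hk
      have ht : t = 0 := Subtype.ext (by linarith [h0.1, h0'.2] : (t : ℝ) = 0)
      have ht' : t' = 1 := Subtype.ext (by linarith [h0.1, h0'.2] : (t' : ℝ) = 1)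
      rw [ht, ht', H.source, H.target]
    · rw [Subtype.ext (by simpa [sub_eq_zero] using hk : (t : ℝ) = t')]
    · push_cast at hk
      have ht : t = 1 := Subtype.ext (by linarith [h0.2, h0'.1] : (t : ℝ) = 1)
      have ht' : t' = 0 := Subtype.ext (by linarith [h0.2, h0'.1] : (t' : ℝ) = 0)
      rw [ht, ht', H.source, H.target]
  · rw [H.apply_zero, H.apply_zero]
    change γ.trans γ t = γ.trans γ t'
    have hf : Int.fract (2 * (t : ℝ)) = Int.fract (2 * (t' : ℝ)) :=
      Int.fract_eq_fract.2 ⟨2 * k + 1, by push_cast; linarith⟩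
    simp only [Path.trans_self_apply_eq_fract, hf]

end Extension

namespace Projectivization

open unitInterval

theorem hemisphere_half_eq_neg : hemisphere 0 (1 / 2) = -hemisphere 0 0 := by
  ext i
  have : 2 * (Real.pi * 2⁻¹) = Real.pi := by ring
  fin_cases i <;> simp [hemisphere, mul_assoc, this]

theorem norm_hemisphere_zero : ‖hemisphere 0 0‖ = 1 := by
  simp [hemisphere, EuclideanSpace.norm_eq, Fin.sum_univ_three]

/-- Half of the boundary circle of the hemisphere. -/
noncomputable def halfCircle :
    Path (⟨hemisphere 0 0, hemisphere_ne_zero _ _⟩ : {v : EuclideanSpace ℝ (Fin 3) // v ≠ 0})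
      ⟨hemisphere 0 (1 / 2), hemisphere_ne_zero _ _⟩ where
  toFun t := ⟨hemisphere 0 (t / 2), hemisphere_ne_zero _ _⟩
  continuous_toFun := Continuous.subtype_mk
    (continuous_hemisphere.comp (by fun_prop : Continuous fun t : I ↦ ((0 : ℝ), (t : ℝ) / 2))) _
  source' := by simp
  target' := by simp

end Projectivization

theorem inducedPiOneHom_mk {X Y : Type} [TopologicalSpace X] [TopologicalSpace Y]
    (f : C(X, Y)) {x : X} (p : Path x x) :
    inducedPiOneHom f x (FundamentalGroup.fromPath (.mk p)) =
      FundamentalGroup.fromPath (.mk (p.map f.continuous)) :=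
  rfl

theorem fundamentalGroupCongr_mk {X : Type} [TopologicalSpace X] {x y : X} (h : x = y)
    (p : Path x x) :
    fundamentalGroupCongr h (FundamentalGroup.fromPath (.mk p)) =
      FundamentalGroup.fromPath (.mk (p.cast h.symm h.symm)) := by
  subst h
  rfl

open unitInterval in
/-- The map from the projective plane to `X` obtained from a null-homotopy of the square of a
loop, which sends the generator of the fundamental group to the class of that loop. -/
theorem exists_map_loopOfPath_halfCircle {X : Type} [TopologicalSpace X] {x₀ : X}
    (γ : Path x₀ x₀) (hγ : (γ.trans γ).Homotopic (Path.refl x₀)) :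
    ∃ (f : C(Projectivization ℝ (EuclideanSpace ℝ (Fin 3)), X))
      (hb : f (.mk' ℝ ⟨Projectivization.hemisphere 0 0,
        Projectivization.hemisphere_ne_zero _ _⟩) = x₀),
      ((Projectivization.loopOfPath Projectivization.halfCircle
        Projectivization.hemisphere_half_eq_neg).map f.continuous).cast hb.symm hb.symm = γ := by
  obtain ⟨H⟩ := hγ
  let f := Projectivization.isQuotientMap_ofPolar.lift H.toContinuousMap H.factorsThrough_ofPolar
  have hf (z : I × I) : f (Projectivization.ofPolar z) = H z :=
    congr($(Projectivization.isQuotientMap_ofPolar.lift_comp H.toContinuousMap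
      H.factorsThrough_ofPolar) z)
  have hfγ (t : I) : f (.mk' ℝ (Projectivization.halfCircle t)) = γ t := by
    let t' : I := ⟨t / 2, by linarith [t.2.1], by linarith [t.2.2]⟩
    have ht' : (t' : ℝ) ≤ 1 / 2 := by change (t : ℝ) / 2 ≤ 1 / 2; linarith [t.2.2]
    refine (hf (0, t')).trans ?_
    rw [H.apply_zero]
    change γ.trans γ t' = γ t
    rw [Path.trans_apply, dif_pos ht']
    congr 1
    exact Subtype.ext (mul_div_cancel₀ _ two_ne_zero)
  refine ⟨f, ?_, Path.ext (funext hfγ)⟩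
  simpa using hfγ 0

/-- Section 4.3.1 of the paper: an element `g` of order dividing two in `π₁(X, x₀)` is
realized by a continuous map `f : ℝP² → X`, i.e. `g` lies in the image of the induced
homomorphism `π₁(ℝP², b) → π₁(X, x₀)`; moreover if `g ≠ 1` then this induced
homomorphism is injective. -/
theorem order_two_element_realized_by_map_of_projective_plane
    {X : Type} [TopologicalSpace X] (x₀ : X) (g : FundamentalGroup X x₀)
    (hg : g ^ 2 = 1) :
    ∃ (b : Projectivization ℝ (EuclideanSpace ℝ (Fin 3)))
      (f : C(Projectivization ℝ (EuclideanSpace ℝ (Fin 3)), X))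
      (hb : f b = x₀),
      g ∈ Set.range ((fundamentalGroupCongr hb).toMonoidHom.comp (inducedPiOneHom f b)) ∧
      (g ≠ 1 → Function.Injective (inducedPiOneHom f b)) := by
  obtain ⟨γ, rfl⟩ : ∃ γ : Path x₀ x₀, FundamentalGroup.fromPath (.mk γ) = g :=
    Path.Homotopic.Quotient.ind (motive := fun g ↦ ∃ γ : Path x₀ x₀, .mk γ = g)
      (fun γ ↦ ⟨γ, rfl⟩) g
  have hγ : (γ.trans γ).Homotopic (Path.refl x₀) :=
    Path.Homotopic.Quotient.exact ((sq _).symm.trans hg)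
  obtain ⟨f, hb, hf⟩ := exists_map_loopOfPath_halfCircle γ hγ
  have key : fundamentalGroupCongr hb (inducedPiOneHom f _ (FundamentalGroup.fromPath
      (.mk (Projectivization.loopOfPath Projectivization.halfCircle
        Projectivization.hemisphere_half_eq_neg)))) = FundamentalGroup.fromPath (.mk γ) := by
    rw [inducedPiOneHom_mk, fundamentalGroupCongr_mk, hf]
  refine ⟨_, f, hb, ⟨_, key⟩, fun hne ↦ (injective_iff_map_eq_one _).2 fun a hc ↦ ?_⟩
  induction a using Path.Homotopic.Quotient.ind with | mk c
  rcases Projectivization.homotopic_refl_or_loopOfPath (by simp)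
    Projectivization.norm_hemisphere_zero Projectivization.halfCircle
    Projectivization.hemisphere_half_eq_neg c with h | h
  · exact Path.Homotopic.Quotient.eq.2 h
  · refine absurd ?_ hne
    rw [Path.Homotopic.Quotient.eq.2 h] at hc
    rw [← key]
    exact (congrArg _ hc).trans (map_one _)
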